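/- Let μ̇ denote the derivative of the logistic function. For all real numbers z₁ and z₂: (i) μ̇(z₁)/(1 + |z₁ − z₂|) ≤ ∫₀¹ μ̇(z₁ + v(z₂ − z₁)) dv; and (ii) if z₁ ≠ z₂, then ∫₀¹ μ̇(z₁ + v(z₂ − z₁)) dv ≤ μ̇(z₁) · (exp(|z₁ − z₂|) − 1)/|z₁ − z₂|. -/

import Mathlib

/-- The logistic (sigmoid) function `μ(x) = 1/(1+exp(−x))`. -/
noncomputable def logistic (x : ℝ) : ℝ := (1 + Real.exp (-x))⁻¹

/-- `μ̇`, the derivative of the logistic function. -/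
noncomputable def logisticDeriv : ℝ → ℝ := deriv logistic

lemma logisticDeriv_eq (x : ℝ) :
    logisticDeriv x = (2 + Real.exp x + Real.exp (-x))⁻¹ := by
  have hpos : 0 < 1 + Real.exp (-x) := by positivity
  have h : HasDerivAt logistic (-(Real.exp (-x) * (-1)) / (1 + Real.exp (-x)) ^ 2) x :=
    ((hasDerivAt_neg x).exp.const_add 1).inv hpos.ne'
  have hden : (1 + Real.exp (-x)) ^ 2 =
      Real.exp (-x) * (2 + Real.exp x + Real.exp (-x)) := by
    have hmul : Real.exp (-x) * Real.exp x = 1 := by rw [← Real.exp_add]; simp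
    linear_combination -hmul
  rw [logisticDeriv, h.deriv, hden]
  field_simp

lemma continuous_logisticDeriv : Continuous logisticDeriv := by
  rw [funext logisticDeriv_eq]
  exact Continuous.inv₀ (by fun_prop) fun x => by positivity

lemma logisticDeriv_nonneg (x : ℝ) : 0 ≤ logisticDeriv x := by
  rw [logisticDeriv_eq]
  positivity

lemma logisticDeriv_le_mul_exp (x y : ℝ) :
    logisticDeriv y ≤ logisticDeriv x * Real.exp |x - y| := by
  have h₀ : 1 ≤ Real.exp |x - y| := Real.one_le_exp (abs_nonneg _)
  have h₁ : Real.exp x ≤ Real.exp |x - y| * Real.exp y := by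
    rw [← Real.exp_add, Real.exp_le_exp]
    linarith [le_abs_self (x - y)]
  have h₂ : Real.exp (-x) ≤ Real.exp |x - y| * Real.exp (-y) := by
    rw [← Real.exp_add, Real.exp_le_exp]
    linarith [neg_abs_le (x - y)]
  rw [logisticDeriv_eq, logisticDeriv_eq, inv_mul_eq_div, inv_eq_one_div,
    div_le_div_iff₀ (by positivity) (by positivity)]
  linarith

lemma integral_exp_mul_unitInterval {c : ℝ} (hc : c ≠ 0) :
    ∫ v in (0:ℝ)..1, Real.exp (c * v) = (Real.exp c - 1) / c := by
  rw [intervalIntegral.integral_comp_mul_left (fun v => Real.exp v) hc, integral_exp]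
  simp [div_eq_inv_mul]

/-- First-order self-concordance control:
(i) `μ̇(z₁)/(1 + |z₁ − z₂|) ≤ ∫₀¹ μ̇(z₁ + v(z₂ − z₁)) dv`, and
(ii) if `z₁ ≠ z₂` then `∫₀¹ μ̇(z₁ + v(z₂ − z₁)) dv ≤ μ̇(z₁)·(exp(|z₁ − z₂|) − 1)/|z₁ − z₂|`. -/
theorem logistic_first_order_self_concordance (z₁ z₂ : ℝ) :
    logisticDeriv z₁ / (1 + |z₁ - z₂|) ≤
      (∫ v in (0:ℝ)..1, logisticDeriv (z₁ + v * (z₂ - z₁))) ∧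
    (z₁ ≠ z₂ →
      (∫ v in (0:ℝ)..1, logisticDeriv (z₁ + v * (z₂ - z₁))) ≤
        logisticDeriv z₁ * (Real.exp |z₁ - z₂| - 1) / |z₁ - z₂|) := by
  rcases eq_or_ne z₁ z₂ with rfl | hne
  · simp
  have ha : 0 < |z₁ - z₂| := abs_pos.mpr (sub_ne_zero.mpr hne)
  have hdist {v : ℝ} (hv : v ∈ Set.Icc (0:ℝ) 1) :
      |z₁ - (z₁ + v * (z₂ - z₁))| = |z₁ - z₂| * v := by
    rw [show z₁ - (z₁ + v * (z₂ - z₁)) = (z₁ - z₂) * v by ring, abs_mul, abs_of_nonneg hv.1]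
  have hint : IntervalIntegrable (fun v : ℝ => logisticDeriv (z₁ + v * (z₂ - z₁)))
      MeasureTheory.volume 0 1 :=
    (continuous_logisticDeriv.comp (by fun_prop)).intervalIntegrable 0 1
  have hexp (c : ℝ) : IntervalIntegrable (fun v : ℝ => logisticDeriv z₁ * Real.exp (c * v))
      MeasureTheory.volume 0 1 :=
    Continuous.intervalIntegrable (by fun_prop) 0 1
  refine ⟨?_, fun _ => ?_⟩
  · calc
      logisticDeriv z₁ / (1 + |z₁ - z₂|)
          ≤ logisticDeriv z₁ * ((Real.exp (-|z₁ - z₂|) - 1) / -|z₁ - z₂|) := by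
        rw [div_eq_mul_inv]
        refine mul_le_mul_of_nonneg_left ?_ (logisticDeriv_nonneg z₁)
        have hle : Real.exp (-|z₁ - z₂|) ≤ (1 + |z₁ - z₂|)⁻¹ := by
          rw [Real.exp_neg]
          exact inv_anti₀ (by positivity) (by linarith [Real.add_one_le_exp |z₁ - z₂|])
        rw [← neg_div_neg_eq, neg_neg, neg_sub, le_div_iff₀ ha]
        have hinv : (1 + |z₁ - z₂|)⁻¹ * (1 + |z₁ - z₂|) = 1 := inv_mul_cancel₀ (by positivity)
        linarith
      _ = ∫ v in (0:ℝ)..1, logisticDeriv z₁ * Real.exp (-|z₁ - z₂| * v) := by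
        rw [intervalIntegral.integral_const_mul,
          integral_exp_mul_unitInterval (neg_ne_zero.mpr ha.ne')]
      _ ≤ ∫ v in (0:ℝ)..1, logisticDeriv (z₁ + v * (z₂ - z₁)) := by
        refine intervalIntegral.integral_mono_on zero_le_one (hexp _) hint fun v hv => ?_
        have h := logisticDeriv_le_mul_exp (z₁ + v * (z₂ - z₁)) z₁
        rw [abs_sub_comm, hdist hv] at h
        rwa [neg_mul, Real.exp_neg, ← div_eq_mul_inv, div_le_iff₀ (Real.exp_pos _)]
  · calc
      ∫ v in (0:ℝ)..1, logisticDeriv (z₁ + v * (z₂ - z₁))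
          ≤ ∫ v in (0:ℝ)..1, logisticDeriv z₁ * Real.exp (|z₁ - z₂| * v) := by
        refine intervalIntegral.integral_mono_on zero_le_one hint (hexp _) fun v hv => ?_
        rw [← hdist hv]
        exact logisticDeriv_le_mul_exp _ _
      _ = logisticDeriv z₁ * (Real.exp |z₁ - z₂| - 1) / |z₁ - z₂| := by
        rw [intervalIntegral.integral_const_mul, integral_exp_mul_unitInterval ha.ne',
          mul_div_assoc]
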